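/- arXiv:2511.02240 — 6 statements merged into one kernel-verified Lean document; each statement's English description precedes it below -/
import Mathlib

section
/- Let γ > 0 and let f : ℝ → ℂ be a continuous 2π-periodic function whose Fourier coefficients satisfy |c_n| ≤ C · e^{−γ|n|} for all n ∈ ℤ and some constant C > 0. Then f extends to a holomorphic function on the open strip {z ∈ ℂ : |Im z| < γ}, given there by the absolutely convergent series Σ_{n∈ℤ} c_n e^{inz}. -/
open Complex Real

theorem summable_exp_neg_mul_abs_int {δ : ℝ} (hδ : 0 < δ) :
    Summable fun n : ℤ => Real.exp (-δ * |(n : ℝ)|) := by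
  have h : Summable fun n : ℕ => Real.exp (-δ * |((n : ℤ) : ℝ)|) := by
    simpa [mul_comm] using Real.summable_exp_nat_mul_iff.mpr (neg_lt_zero.mpr hδ)
  exact Summable.of_nat_of_neg h (by simpa using h)

theorem norm_mul_exp_le_of_abs_im_le {γ C b : ℝ} {c : ℤ → ℂ}
    (hdecay : ∀ n : ℤ, ‖c n‖ ≤ C * Real.exp (-γ * |(n : ℝ)|))
    {z : ℂ} (hz : |z.im| ≤ b) (n : ℤ) :
    ‖c n * Complex.exp (Complex.I * (n : ℂ) * z)‖ ≤ C * Real.exp (-(γ - b) * |(n : ℝ)|) := by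
  have hexp : ‖Complex.exp (Complex.I * (n : ℂ) * z)‖ ≤ Real.exp (b * |(n : ℝ)|) := by
    have hre : (Complex.I * (n : ℂ) * z).re = -((n : ℝ) * z.im) := by simp
    rw [Complex.norm_exp, hre]
    refine Real.exp_le_exp.mpr ((neg_le_abs _).trans ?_)
    rw [abs_mul, mul_comm]
    gcongr
  calc ‖c n * Complex.exp (Complex.I * (n : ℂ) * z)‖
      = ‖c n‖ * ‖Complex.exp (Complex.I * (n : ℂ) * z)‖ := norm_mul _ _
    _ ≤ C * Real.exp (-γ * |(n : ℝ)|) * Real.exp (b * |(n : ℝ)|) :=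
        mul_le_mul (hdecay n) hexp (norm_nonneg _) ((norm_nonneg _).trans (hdecay n))
    _ = C * Real.exp (-(γ - b) * |(n : ℝ)|) := by
        rw [mul_assoc, ← Real.exp_add]
        ring_nf

theorem differentiableOn_tsum_exp_of_decay {γ C : ℝ} {c : ℤ → ℂ}
    (hdecay : ∀ n : ℤ, ‖c n‖ ≤ C * Real.exp (-γ * |(n : ℝ)|)) :
    DifferentiableOn ℂ (fun z => ∑' n : ℤ, c n * Complex.exp (Complex.I * (n : ℂ) * z))
      {z : ℂ | |z.im| < γ} := by
  intro z hz
  obtain ⟨b, hzb, hbγ⟩ := exists_between (show |z.im| < γ from hz)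
  have hopen : IsOpen {w : ℂ | |w.im| < b} :=
    isOpen_lt (continuous_abs.comp Complex.continuous_im) continuous_const
  have hdiff := differentiableOn_tsum_of_summable_norm
    (F := fun (n : ℤ) (w : ℂ) => c n * Complex.exp (Complex.I * (n : ℂ) * w))
    ((summable_exp_neg_mul_abs_int (sub_pos.mpr hbγ)).mul_left C)
    (fun n => by fun_prop) hopen
    (fun n w hw => norm_mul_exp_le_of_abs_im_le hdecay (le_of_lt hw) n)
  exact (hdiff.differentiableAt (hopen.mem_nhds hzb)).differentiableWithinAt

theorem hasSum_fourier_series_of_periodic {f : ℝ → ℂ} (hf : Continuous f)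
    (hper : Function.Periodic f (2 * Real.pi)) {c : ℤ → ℂ}
    (hc : ∀ n : ℤ, c n =
      (1 / (2 * Real.pi)) • ∫ k in (-Real.pi)..Real.pi,
        f k * Complex.exp (-Complex.I * (n : ℂ) * (k : ℂ)))
    (hsum : Summable c) (x : ℝ) :
    HasSum (fun n : ℤ => c n * Complex.exp (Complex.I * (n : ℂ) * (x : ℂ))) (f x) := by
  have : Fact (0 < 2 * Real.pi) := ⟨Real.two_pi_pos⟩
  have hfourier (n : ℤ) (k : ℝ) : fourier n (k : AddCircle (2 * Real.pi)) =
      Complex.exp (Complex.I * (n : ℂ) * (k : ℂ)) := by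
    rw [fourier_coe_apply]
    congr 1
    have hpi : (Real.pi : ℂ) ≠ 0 := Complex.ofReal_ne_zero.mpr Real.pi_ne_zero
    push_cast
    field_simp
  let g : C(AddCircle (2 * Real.pi), ℂ) := ⟨hper.lift, hf.quotient_lift _⟩
  have hg (k : ℝ) : g k = f k := hper.lift_coe k
  have hcoeff : fourierCoeff g = c := by
    funext n
    rw [fourierCoeff_eq_intervalIntegral _ _ (-Real.pi), hc,
      show -Real.pi + 2 * Real.pi = Real.pi by ring]
    congr 1
    refine intervalIntegral.integral_congr fun k _ => ?_
    simp only [hfourier, hg, smul_eq_mul, Int.cast_neg]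
    rw [mul_comm, mul_neg, neg_mul Complex.I]
  have h := has_pointwise_sum_fourier_series_of_summable (hcoeff ▸ hsum) (x : AddCircle _)
  simpa only [hcoeff, hfourier, hg, smul_eq_mul] using h

/-- **Paley–Wiener (converse direction) for periodic functions.**
If a continuous `2π`-periodic function `f : ℝ → ℂ` has Fourier coefficients bounded by
`C e^{-γ|n|}`, then `f` extends to a holomorphic function on the strip `{z : |Im z| < γ}`,
given there by the absolutely convergent series `Σ_{n∈ℤ} c_n e^{inz}`. -/
theorem paley_wiener_converse (γ : ℝ) (hγ : 0 < γ) (f : ℝ → ℂ) (hf : Continuous f)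
    (hper : ∀ x : ℝ, f (x + 2 * Real.pi) = f x)
    (c : ℤ → ℂ)
    (hc : ∀ n : ℤ, c n =
      (1 / (2 * Real.pi)) • ∫ k in (-Real.pi)..Real.pi,
        f k * Complex.exp (-Complex.I * (n : ℂ) * (k : ℂ)))
    (C : ℝ) (hC : 0 < C)
    (hdecay : ∀ n : ℤ, ‖c n‖ ≤ C * Real.exp (-γ * |(n : ℝ)|)) :
    ∃ F : ℂ → ℂ, DifferentiableOn ℂ F {z : ℂ | |z.im| < γ} ∧
      (∀ x : ℝ, F (x : ℂ) = f x) ∧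
      ∀ z : ℂ, |z.im| < γ →
        Summable (fun n : ℤ => ‖c n * Complex.exp (Complex.I * (n : ℂ) * z)‖) ∧
        F z = ∑' n : ℤ, c n * Complex.exp (Complex.I * (n : ℂ) * z) := by
  have hsummable {z : ℂ} (hz : |z.im| < γ) :
      Summable fun n : ℤ => ‖c n * Complex.exp (Complex.I * (n : ℂ) * z)‖ :=
    ((summable_exp_neg_mul_abs_int (sub_pos.mpr hz)).mul_left C).of_nonneg_of_le
      (fun _ => norm_nonneg _) (norm_mul_exp_le_of_abs_im_le hdecay le_rfl)
  have hc_summable : Summable c :=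
    ((summable_exp_neg_mul_abs_int hγ).mul_left C).of_norm_bounded hdecay
  exact ⟨fun z => ∑' n : ℤ, c n * Complex.exp (Complex.I * (n : ℂ) * z),
    differentiableOn_tsum_exp_of_decay hdecay,
    fun x => (hasSum_fourier_series_of_periodic hf hper hc hc_summable x).tsum_eq,
    fun z hz => ⟨hsummable hz, rfl⟩⟩
end

section
/- Let λ be a real number with 0 < λ < 1/2. Then the set of complex solutions k ∈ ℂ of the equation 1 + 2λ·cos(k) = 0 is exactly {π + 2πm + i·arccosh(1/(2λ)) : m ∈ ℤ} ∪ {π + 2πm − i·arccosh(1/(2λ)) : m ∈ ℤ}. In particular, every solution satisfies |Im k| = arccosh(1/(2λ)), there are no real solutions, and the maximum of 1/|Im k| over all solutions equals 1/arccosh(1/(2λ)). -/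
open Complex Real

/-- `arccosh x = ln (x + √(x² − 1))` for `x ≥ 1`. -/
noncomputable def arccosh (x : ℝ) : ℝ := Real.log (x + Real.sqrt (x ^ 2 - 1))

/-- `arccosh` agrees with Mathlib's `Real.arcosh`. -/
theorem arccosh_eq_arcosh (x : ℝ) : arccosh x = Real.arcosh x := rfl

/-- The complex solutions of `1 + 2 b cos k = 0` when `2 b cosh a = 1`. -/
theorem one_add_two_mul_cos_eq_zero_iff {a b : ℝ} (h : 2 * b * Real.cosh a = 1) (k : ℂ) :
    1 + 2 * (b : ℂ) * Complex.cos k = 0 ↔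
      (∃ m : ℤ, k = (Real.pi : ℂ) + 2 * (Real.pi : ℂ) * (m : ℂ) + Complex.I * (a : ℂ)) ∨
      (∃ m : ℤ, k = (Real.pi : ℂ) + 2 * (Real.pi : ℂ) * (m : ℂ) - Complex.I * (a : ℂ)) := by
  have hc : 2 * (b : ℂ) * Complex.cosh a = 1 := by exact_mod_cast h
  have hb : 2 * (b : ℂ) ≠ 0 := left_ne_zero_of_mul_eq_one hc
  have hcos : Complex.cos (Complex.I * a + Real.pi) = -Complex.cosh a := by
    rw [Complex.cos_add_pi, mul_comm, Complex.cos_mul_I]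
  have key : 1 + 2 * (b : ℂ) * Complex.cos k = 0 ↔
      Complex.cos (Complex.I * a + Real.pi) = Complex.cos k := by
    rw [hcos, ← mul_right_inj' hb (b := -Complex.cosh a)]
    constructor <;> intro hk <;> linear_combination -hk - hc
  rw [key, Complex.cos_eq_cos_iff]
  constructor
  · rintro ⟨m, rfl | rfl⟩
    · exact Or.inl ⟨m, by ring⟩
    · exact Or.inr ⟨m - 1, by push_cast; ring⟩
  · rintro (⟨m, rfl⟩ | ⟨m, rfl⟩)
    · exact ⟨m, Or.inl (by ring)⟩
    · exact ⟨m + 1, Or.inr (by push_cast; ring)⟩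

/-- For `0 < λ < 1/2`, the complex solutions of `1 + 2λ cos k = 0` are exactly
`π + 2πm ± i·arccosh(1/(2λ))`, every solution satisfies `|Im k| = arccosh(1/(2λ))`,
there are no real solutions, and the maximum of `1/|Im k|` over all solutions is
`1/arccosh(1/(2λ))`. -/
theorem flat_band_zeros (lam : ℝ) (h0 : 0 < lam) (h1 : lam < 1 / 2) :
    ({k : ℂ | 1 + 2 * (lam : ℂ) * Complex.cos k = 0} =
      {k : ℂ | ∃ m : ℤ, k = (Real.pi : ℂ) + 2 * (Real.pi : ℂ) * (m : ℂ)
          + Complex.I * (arccosh (1 / (2 * lam)) : ℂ)} ∪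
      {k : ℂ | ∃ m : ℤ, k = (Real.pi : ℂ) + 2 * (Real.pi : ℂ) * (m : ℂ)
          - Complex.I * (arccosh (1 / (2 * lam)) : ℂ)}) ∧
    (∀ k : ℂ, 1 + 2 * (lam : ℂ) * Complex.cos k = 0 →
      |k.im| = arccosh (1 / (2 * lam))) ∧
    (∀ k : ℂ, 1 + 2 * (lam : ℂ) * Complex.cos k = 0 → k.im ≠ 0) ∧
    IsGreatest {r : ℝ | ∃ k : ℂ, 1 + 2 * (lam : ℂ) * Complex.cos k = 0 ∧ r = 1 / |k.im|}
      (1 / arccosh (1 / (2 * lam))) := by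
  have hx : 1 < 1 / (2 * lam) := by rw [lt_div_iff₀ (by linarith)]; linarith
  have hpos : 0 < arccosh (1 / (2 * lam)) := Real.arcosh_pos hx
  have hcosh : 2 * lam * Real.cosh (arccosh (1 / (2 * lam))) = 1 := by
    rw [arccosh_eq_arcosh, Real.cosh_arcosh hx.le]
    field_simp
  have hiff := one_add_two_mul_cos_eq_zero_iff hcosh
  generalize arccosh (1 / (2 * lam)) = a at hpos hiff ⊢
  have him : ∀ k : ℂ, 1 + 2 * (lam : ℂ) * Complex.cos k = 0 → |k.im| = a := by
    intro k hk
    rcases (hiff k).1 hk with ⟨m, rfl⟩ | ⟨m, rfl⟩ <;> simp [abs_of_pos hpos]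
  refine ⟨Set.ext hiff, him, ?_, ?_, ?_⟩
  · intro k hk
    exact abs_pos.1 (him k hk ▸ hpos)
  · have hk := (hiff _).2 (Or.inl ⟨0, rfl⟩)
    exact ⟨_, hk, by rw [him _ hk]⟩
  · rintro r ⟨k, hk, rfl⟩
    rw [him k hk]
end

section
/- Let d be a nonzero real number. Then every complex solution k ∈ ℂ of the equation 1 + (2/(2+d²))·cos(k) = 0 satisfies |Im k| = arccosh((2+d²)/2), there are no real solutions, and the maximum of 1/|Im k| over all solutions equals 1/arccosh((2+d²)/2). -/
open Complex Real

theorem one_add_two_div_mul_eq_zero_iff (d : ℝ) (z : ℂ) :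
    1 + (2 / (2 + (d : ℂ) ^ 2)) * z = 0 ↔ z = -(((2 + d ^ 2) / 2 : ℝ) : ℂ) := by
  have h : (2 + (d : ℂ) ^ 2) ≠ 0 := by
    have : (2 + d ^ 2 : ℝ) ≠ 0 := by positivity
    exact_mod_cast this
  push_cast
  constructor
  · intro hz
    field_simp at hz ⊢
    linear_combination hz
  · rintro rfl
    field_simp
    ring

/-- Solutions of `cos k = -x` with `x > 1` all lie at height `± arcosh x`. -/
theorem abs_im_eq_arcosh_of_cos_eq_neg {x : ℝ} (hx : 1 < x) {k : ℂ}
    (hk : Complex.cos k = -(x : ℂ)) : |k.im| = Real.arcosh x := by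
  rw [Complex.cos_eq] at hk
  have hre : Real.cos k.re * Real.cosh k.im = -x := by
    have := congrArg Complex.re hk
    simpa [← Complex.ofReal_cos, ← Complex.ofReal_sin, ← Complex.ofReal_cosh,
      ← Complex.ofReal_sinh] using this
  have him : Real.sin k.re * Real.sinh k.im = 0 := by
    have := congrArg Complex.im hk
    simpa [← Complex.ofReal_cos, ← Complex.ofReal_sin, ← Complex.ofReal_cosh,
      ← Complex.ofReal_sinh] using this
  have hsin : Real.sin k.re = 0 := by
    refine (mul_eq_zero.mp him).resolve_right fun h ↦ ?_
    rw [Real.sinh_eq_zero.mp h, Real.cosh_zero] at hre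
    linarith [Real.neg_one_le_cos k.re]
  have hcosh : Real.cosh k.im = x := by
    have hpos := Real.cosh_pos k.im
    rcases Real.sin_eq_zero_iff_cos_eq.mp hsin with h | h <;> rw [h] at hre <;> linarith
  rw [← hcosh, ← Real.cosh_abs, Real.arcosh_cosh (abs_nonneg _)]

theorem cos_pi_add_arcosh_mul_I {x : ℝ} (hx : 1 ≤ x) :
    Complex.cos (π + Real.arcosh x * I) = -(x : ℂ) := by
  rw [add_comm, Complex.cos_add_pi, Complex.cos_mul_I, ← Complex.ofReal_cosh,
    Real.cosh_arcosh hx]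

/-- **Stub lattice flat-band length scale.** For `d ≠ 0`, every complex solution of
`1 + (2/(2+d²)) cos k = 0` satisfies `|Im k| = arccosh((2+d²)/2)`, there are no real
solutions, and the maximum of `1/|Im k|` over all solutions is `1/arccosh((2+d²)/2)`. -/
theorem stub_lattice_xi_flat (d : ℝ) (hd : d ≠ 0) :
    (∀ k : ℂ, 1 + (2 / (2 + (d : ℂ) ^ 2)) * Complex.cos k = 0 →
      |k.im| = arccosh ((2 + d ^ 2) / 2)) ∧
    (∀ k : ℂ, 1 + (2 / (2 + (d : ℂ) ^ 2)) * Complex.cos k = 0 → k.im ≠ 0) ∧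
    IsGreatest {r : ℝ | ∃ k : ℂ,
        (1 + (2 / (2 + (d : ℂ) ^ 2)) * Complex.cos k = 0) ∧ r = 1 / |k.im|}
      (1 / arccosh ((2 + d ^ 2) / 2)) := by
  simp only [one_add_two_div_mul_eq_zero_iff, arccosh_eq_arcosh]
  have hx : 1 < (2 + d ^ 2) / 2 := by
    have : 0 < d ^ 2 := by positivity
    linarith
  generalize (2 + d ^ 2) / 2 = x at hx
  have habs (k : ℂ) (hk : Complex.cos k = -(x : ℂ)) : |k.im| = Real.arcosh x :=
    abs_im_eq_arcosh_of_cos_eq_neg hx hk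
  refine ⟨habs, fun k hk ↦ abs_pos.mp (habs k hk ▸ Real.arcosh_pos hx), ?_, ?_⟩
  · have hk := cos_pi_add_arcosh_mul_I hx.le
    exact ⟨_, hk, by rw [habs _ hk]⟩
  · rintro r ⟨k, hk, rfl⟩
    rw [habs k hk]
end

section
/- Let k₀ ∈ ℝ and let E(z) = E₀ + Σ_{i=2}^{∞} c_i (z − k₀)^i be a convergent power series on a neighborhood of k₀ with all coefficients c_i real and c₂ ≠ 0. Then there exists ε₀ > 0 such that for every ε ∈ (0, ε₀) there is an angle φ ∈ (π/4, 3π/4) with Im E(k₀ + ε·e^{iφ}) = 0. In particular, there exist non-real complex numbers z arbitrarily close to k₀ with E(z) ∈ ℝ. -/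
open Complex Real

lemma norm_ofReal_mul_exp {ε : ℝ} (hε : 0 ≤ ε) (φ : ℝ) :
    ‖(ε : ℂ) * Complex.exp (Complex.I * φ)‖ = ε := by
  rw [mul_comm Complex.I, norm_mul, Complex.norm_exp_ofReal_mul_I, mul_one, Complex.norm_real,
    Real.norm_of_nonneg hε]

section PowerSeries

variable {a : ℕ → ℂ} {f : ℂ → ℂ} {r : ℝ}

/-- A power series convergent on the disc of radius `r` converges absolutely on the circle of
radius `ρ < r`. -/
lemma summable_norm_mul_pow_of_hasSum
    (hf : ∀ w : ℂ, ‖w‖ < r → HasSum (fun i : ℕ => a i * w ^ (i + 2)) (f w))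
    {ρ : ℝ} (hρ : 0 ≤ ρ) (hρr : ρ < r) : Summable fun i : ℕ => ‖a i‖ * ρ ^ (i + 2) := by
  have h := (hf ρ (by simpa [abs_of_nonneg hρ] using hρr)).summable.norm
  simpa [abs_of_nonneg hρ] using h

/-- The sum of a power series is continuous on every circle inside its disc of convergence. -/
lemma continuous_comp_circle_of_hasSum
    (hf : ∀ w : ℂ, ‖w‖ < r → HasSum (fun i : ℕ => a i * w ^ (i + 2)) (f w))
    {ρ : ℝ} (hρ : 0 ≤ ρ) (hρr : ρ < r) :
    Continuous fun φ : ℝ => f (ρ * Complex.exp (Complex.I * φ)) := by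
  have heq : (fun φ : ℝ => f (ρ * Complex.exp (Complex.I * φ))) =
      fun φ : ℝ => ∑' i : ℕ, a i * ((ρ : ℂ) * Complex.exp (Complex.I * φ)) ^ (i + 2) :=
    funext fun φ => (hf _ ((norm_ofReal_mul_exp hρ φ).trans_lt hρr)).tsum_eq.symm
  rw [heq]
  refine continuous_tsum (fun i => by fun_prop) (summable_norm_mul_pow_of_hasSum hf hρ hρr) ?_
  intro i φ
  rw [norm_mul, norm_pow, norm_ofReal_mul_exp hρ]

/-- The remainder of a power series after its quadratic leading term is cubic. -/
lemma exists_norm_sub_quadratic_le_of_hasSum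
    (hf : ∀ w : ℂ, ‖w‖ < r → HasSum (fun i : ℕ => a i * w ^ (i + 2)) (f w))
    {ρ : ℝ} (hρ : 0 < ρ) (hρr : ρ < r) :
    ∃ C : ℝ, 0 ≤ C ∧ ∀ w : ℂ, ‖w‖ ≤ ρ → ‖f w - a 0 * w ^ 2‖ ≤ C * ‖w‖ ^ 3 := by
  have hs := (summable_nat_add_iff 1).2 (summable_norm_mul_pow_of_hasSum hf hρ.le hρr)
  have hs' : Summable fun i : ℕ => ‖a (i + 1)‖ * ρ ^ i := by
    refine (hs.mul_right (ρ ^ 3)⁻¹).congr fun i => ?_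
    field_simp
    ring
  refine ⟨∑' i : ℕ, ‖a (i + 1)‖ * ρ ^ i, tsum_nonneg fun i => by positivity, fun w hw => ?_⟩
  have htail := (hasSum_nat_add_iff' 1).2 (hf w (hw.trans_lt hρr))
  simp only [Finset.sum_range_one, zero_add] at htail
  rw [← htail.tsum_eq]
  refine tsum_of_norm_bounded (hs'.hasSum.mul_right (‖w‖ ^ 3)) fun i => ?_
  calc ‖a (i + 1) * w ^ (i + 1 + 2)‖ = ‖a (i + 1)‖ * ‖w‖ ^ i * ‖w‖ ^ 3 := by
        rw [norm_mul, norm_pow]; ring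
    _ ≤ ‖a (i + 1)‖ * ρ ^ i * ‖w‖ ^ 3 := by gcongr

end PowerSeries

lemma ofReal_mul_exp_pi_div_four_sq (ε : ℝ) :
    ((ε : ℂ) * Complex.exp (Complex.I * ((Real.pi / 4 : ℝ) : ℂ))) ^ 2 =
      (ε : ℂ) ^ 2 * Complex.I := by
  rw [mul_pow, ← Complex.exp_nat_mul]
  congr 1
  refine Eq.trans (congrArg Complex.exp ?_) Complex.exp_pi_div_two_mul_I
  push_cast
  ring

lemma ofReal_mul_exp_three_pi_div_four_sq (ε : ℝ) :
    ((ε : ℂ) * Complex.exp (Complex.I * ((3 * Real.pi / 4 : ℝ) : ℂ))) ^ 2 =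
      -((ε : ℂ) ^ 2 * Complex.I) := by
  have h : (3 * Real.pi / 4 : ℝ) = Real.pi / 4 + Real.pi / 2 := by ring
  rw [h, Complex.ofReal_add, mul_add, Complex.exp_add, ← mul_assoc, mul_pow,
    ofReal_mul_exp_pi_div_four_sq]
  push_cast
  rw [mul_comm Complex.I, Complex.exp_pi_div_two_mul_I]
  simp

lemma im_ofReal_mul_exp (ε φ : ℝ) :
    ((ε : ℂ) * Complex.exp (Complex.I * φ)).im = ε * Real.sin φ := by
  rw [mul_comm Complex.I, Complex.im_ofReal_mul, Complex.exp_ofReal_mul_I_im]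

/-- **Real-energy arcs emanate from nondegenerate band extrema.** Let
`E(z) = E₀ + Σ_{i≥2} c_i (z − k₀)^i` be a convergent power series near `k₀ ∈ ℝ` with real
coefficients and `c₂ ≠ 0`. Then there is `ε₀ > 0` such that for every `ε ∈ (0, ε₀)` there is
an angle `φ ∈ (π/4, 3π/4)` with `Im E(k₀ + ε e^{iφ}) = 0`; in particular there exist non-real
`z` arbitrarily close to `k₀` with `E(z) ∈ ℝ`. -/
theorem real_energy_arcs_from_extremum (k₀ E₀ : ℝ) (c : ℕ → ℝ) (hc2 : c 2 ≠ 0)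
    (E : ℂ → ℂ) (r : ℝ) (hr : 0 < r)
    (hE : ∀ z : ℂ, ‖z - (k₀ : ℂ)‖ < r →
      HasSum (fun i : ℕ => ((c (i + 2) : ℂ)) * (z - (k₀ : ℂ)) ^ (i + 2)) (E z - (E₀ : ℂ))) :
    (∃ ε₀ : ℝ, 0 < ε₀ ∧ ∀ ε : ℝ, 0 < ε → ε < ε₀ →
      ∃ φ : ℝ, φ ∈ Set.Ioo (Real.pi / 4) (3 * Real.pi / 4) ∧
        (E ((k₀ : ℂ) + (ε : ℂ) * Complex.exp (Complex.I * (φ : ℂ)))).im = 0) ∧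
    ∀ δ : ℝ, 0 < δ → ∃ z : ℂ, z.im ≠ 0 ∧ ‖z - (k₀ : ℂ)‖ < δ ∧ (E z).im = 0 := by
  set f : ℂ → ℂ := fun w => E (k₀ + w) - E₀ with hf_def
  have hf : ∀ w : ℂ, ‖w‖ < r →
      HasSum (fun i : ℕ => (c (i + 2) : ℂ) * w ^ (i + 2)) (f w) := fun w hw => by
    simpa [hf_def] using hE (k₀ + w) (by simpa using hw)
  obtain ⟨C, hC, hrem⟩ := exists_norm_sub_quadratic_le_of_hasSum hf (half_pos hr) (half_lt_self hr)
  have arcs : ∃ ε₀ : ℝ, 0 < ε₀ ∧ ∀ ε : ℝ, 0 < ε → ε < ε₀ →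
      ∃ φ : ℝ, φ ∈ Set.Ioo (Real.pi / 4) (3 * Real.pi / 4) ∧
        (E ((k₀ : ℂ) + (ε : ℂ) * Complex.exp (Complex.I * (φ : ℂ)))).im = 0 := by
    have hc : 0 < |c 2| := abs_pos.2 hc2
    refine ⟨min (r / 2) (|c 2| / (C + 1)), by positivity, fun ε hε hlt => ?_⟩
    have hεr : ε < r / 2 := hlt.trans_le (min_le_left _ _)
    have hεC : C * ε < |c 2| := by
      have := (lt_div_iff₀ (by positivity)).1 (hlt.trans_le (min_le_right _ _))
      nlinarith
    have hcubic : C * ε ^ 3 < |c 2| * ε ^ 2 := by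
      have := mul_lt_mul_of_pos_right hεC (pow_pos hε 2)
      linarith [show C * ε * ε ^ 2 = C * ε ^ 3 by ring]
    have him : ∀ φ : ℝ, |(f (ε * Complex.exp (Complex.I * φ))).im -
        c 2 * (((ε : ℂ) * Complex.exp (Complex.I * φ)) ^ 2).im| < |c 2| * ε ^ 2 := fun φ => by
      have h := hrem _ ((norm_ofReal_mul_exp hε.le φ).trans_le hεr.le)
      rw [norm_ofReal_mul_exp hε.le] at h
      have h' := (Complex.abs_im_le_norm _).trans_lt (h.trans_lt hcubic)
      rwa [Complex.sub_im, Complex.im_ofReal_mul] at h'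
    have hsq : ((ε : ℂ) ^ 2 * Complex.I).im = ε ^ 2 := by
      rw [← Complex.ofReal_pow, Complex.im_ofReal_mul, Complex.I_im, mul_one]
    have h₁ := him (Real.pi / 4)
    have h₂ := him (3 * Real.pi / 4)
    rw [ofReal_mul_exp_pi_div_four_sq, hsq] at h₁
    rw [ofReal_mul_exp_three_pi_div_four_sq, Complex.neg_im, hsq] at h₂
    have hcont : Continuous fun φ : ℝ => (f (ε * Complex.exp (Complex.I * φ))).im :=
      Complex.continuous_im.comp
        (continuous_comp_circle_of_hasSum hf hε.le (by linarith))
    have hpi : Real.pi / 4 ≤ 3 * Real.pi / 4 := by linarith [Real.pi_pos]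
    have hzero : (0 : ℝ) ∈ (fun φ : ℝ => (f (ε * Complex.exp (Complex.I * φ))).im) ''
        Set.Ioo (Real.pi / 4) (3 * Real.pi / 4) := by
      rw [abs_lt] at h₁ h₂
      rcases hc2.lt_or_gt with hneg | hpos
      · rw [abs_of_neg hneg] at h₁ h₂
        exact intermediate_value_Ioo hpi hcont.continuousOn ⟨by linarith, by linarith⟩
      · rw [abs_of_pos hpos] at h₁ h₂
        exact intermediate_value_Ioo' hpi hcont.continuousOn ⟨by linarith, by linarith⟩
    obtain ⟨φ, hφ, h0⟩ := hzero
    exact ⟨φ, hφ, by simpa [hf_def] using h0⟩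
  refine ⟨arcs, fun δ hδ => ?_⟩
  obtain ⟨ε₀, hε₀, harc⟩ := arcs
  have hmin : 0 < min ε₀ δ := lt_min hε₀ hδ
  have hε := half_pos hmin
  have hlt := half_lt_self hmin
  obtain ⟨φ, hφ, h0⟩ := harc _ hε (hlt.trans_le (min_le_left _ _))
  refine ⟨_, ?_, ?_, h0⟩
  · rw [Complex.add_im, Complex.ofReal_im, zero_add, im_ofReal_mul_exp]
    have hsin : 0 < Real.sin φ :=
      Real.sin_pos_of_pos_of_lt_pi (by linarith [hφ.1, Real.pi_pos])
        (by linarith [hφ.2, Real.pi_pos])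
    exact (mul_pos hε hsin).ne'
  · rw [add_sub_cancel_left, norm_ofReal_mul_exp hε.le]
    exact hlt.trans_le (min_le_right _ _)
end

section
/- Fix a real number T > 0 and define, for λ ∈ (0, 1/2), ξ(λ) = T/arccosh(1/(2λ)) and σ(λ) = T²/(4·√(1 − 4λ²)). Then both ξ and σ are differentiable and strictly increasing on (0, 1/2), and the ratio of their derivatives satisfies lim_{λ → (1/2)⁻} ξ'(λ)/σ'(λ) = 4/T. -/
open Real Filter

theorem one_lt_one_div_two_mul {l : ℝ} (hl : l ∈ Set.Ioo (0 : ℝ) (1 / 2)) :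
    1 < 1 / (2 * l) := by
  rw [lt_div_iff₀ (by linarith [hl.1])]
  linarith [hl.2]

theorem one_sub_four_mul_sq_pos {l : ℝ} (hl : l ∈ Set.Ioo (0 : ℝ) (1 / 2)) :
    0 < 1 - 4 * l ^ 2 := by
  nlinarith [hl.1, hl.2]

theorem sinh_arcosh_one_div_two_mul {l : ℝ} (hl : l ∈ Set.Ioo (0 : ℝ) (1 / 2)) :
    Real.sinh (Real.arcosh (1 / (2 * l))) = √(1 - 4 * l ^ 2) / (2 * l) := by
  have hl0 := hl.1
  rw [Real.sinh_arcosh (one_lt_one_div_two_mul hl).le,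
    show (1 / (2 * l)) ^ 2 - 1 = (1 - 4 * l ^ 2) / (2 * l) ^ 2 by field_simp; ring,
    Real.sqrt_div' _ (by positivity), Real.sqrt_sq (by positivity)]

theorem hasDerivAt_arcosh_one_div_two_mul {l : ℝ} (hl : l ∈ Set.Ioo (0 : ℝ) (1 / 2)) :
    HasDerivAt (fun x : ℝ => Real.arcosh (1 / (2 * x))) (-(1 / (l * √(1 - 4 * l ^ 2)))) l := by
  have hl0 := hl.1
  have hs : 0 < √(1 - 4 * l ^ 2) := Real.sqrt_pos.2 (one_sub_four_mul_sq_pos hl)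
  have hinner : HasDerivAt (fun x : ℝ => 1 / (2 * x)) (-(1 / (2 * l ^ 2))) l := by
    have h := ((hasDerivAt_id l).const_mul 2).fun_inv (by simpa using hl0.ne')
    simp only [id, ← one_div] at h
    refine h.congr_deriv ?_
    field_simp
  have h := (Real.hasDerivAt_arcosh (one_lt_one_div_two_mul hl)).comp l hinner
  rw [← Real.sinh_arcosh (one_lt_one_div_two_mul hl).le, sinh_arcosh_one_div_two_mul hl] at h
  refine h.congr_deriv ?_
  field_simp

theorem hasDerivAt_div_arcosh_one_div_two_mul (T : ℝ) {l : ℝ}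
    (hl : l ∈ Set.Ioo (0 : ℝ) (1 / 2)) :
    HasDerivAt (fun x : ℝ => T / Real.arcosh (1 / (2 * x)))
      (T / (Real.arcosh (1 / (2 * l)) ^ 2 * (l * √(1 - 4 * l ^ 2)))) l := by
  have hA := Real.arcosh_pos (one_lt_one_div_two_mul hl)
  have h := (hasDerivAt_const l T).fun_div (hasDerivAt_arcosh_one_div_two_mul hl) hA.ne'
  refine h.congr_deriv ?_
  have hl0 := hl.1
  have hs : 0 < √(1 - 4 * l ^ 2) := Real.sqrt_pos.2 (one_sub_four_mul_sq_pos hl)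
  generalize Real.arcosh (1 / (2 * l)) = A at *
  field_simp
  ring

theorem hasDerivAt_div_sqrt_one_sub_four_mul_sq (T : ℝ) {l : ℝ}
    (hl : l ∈ Set.Ioo (0 : ℝ) (1 / 2)) :
    HasDerivAt (fun x : ℝ => T ^ 2 / (4 * √(1 - 4 * x ^ 2)))
      (T ^ 2 * l / √(1 - 4 * l ^ 2) ^ 3) l := by
  have hpos := one_sub_four_mul_sq_pos hl
  have hs : 0 < √(1 - 4 * l ^ 2) := Real.sqrt_pos.2 hpos
  have hinner : HasDerivAt (fun x : ℝ => 1 - 4 * x ^ 2) (-(8 * l)) l := by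
    refine (((hasDerivAt_pow 2 l).const_mul 4).const_sub 1).congr_deriv ?_
    norm_num
    ring
  have h := (hasDerivAt_const l (T ^ 2)).fun_div ((hinner.sqrt hpos.ne').const_mul 4)
    (by positivity)
  refine h.congr_deriv ?_
  field_simp
  ring

theorem tendsto_sinh_div_self : Tendsto (fun x : ℝ => Real.sinh x / x) (nhdsWithin 0 {0}ᶜ)
    (nhds 1) := by
  have h := hasDerivAt_iff_tendsto_slope.1 (Real.hasDerivAt_sinh 0)
  rw [Real.cosh_zero] at h
  refine h.congr fun x => ?_
  simp [slope_def_field]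

theorem Ioo_zero_half_mem_nhdsWithin :
    Set.Ioo (0 : ℝ) (1 / 2) ∈ nhdsWithin (1 / 2 : ℝ) (Set.Iio (1 / 2)) :=
  Ioo_mem_nhdsLT (by norm_num)

theorem tendsto_arcosh_one_div_two_mul :
    Tendsto (fun l : ℝ => Real.arcosh (1 / (2 * l))) (nhdsWithin (1 / 2) (Set.Iio (1 / 2)))
      (nhdsWithin 0 {0}ᶜ) := by
  refine tendsto_nhdsWithin_iff.2 ⟨?_, ?_⟩
  · have hcont : ContinuousWithinAt Real.arcosh (Set.Ici 1) 1 :=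
      Real.continuousOn_arcosh 1 Set.self_mem_Ici
    rw [ContinuousWithinAt, Real.arcosh_zero] at hcont
    refine hcont.comp (tendsto_nhdsWithin_iff.2 ⟨?_, ?_⟩)
    · have h : ContinuousAt (fun l : ℝ => 1 / (2 * l)) (1 / 2) := by
        fun_prop (disch := norm_num)
      have ht := h.tendsto.mono_left (nhdsWithin_le_nhds (s := Set.Iio (1 / 2)))
      norm_num at ht ⊢
      exact ht
    · filter_upwards [Ioo_zero_half_mem_nhdsWithin] with l hl
      exact (one_lt_one_div_two_mul hl).le
  · filter_upwards [Ioo_zero_half_mem_nhdsWithin] with l hl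
    exact (Real.arcosh_pos (one_lt_one_div_two_mul hl)).ne'

/-- For fixed `T > 0`, the functions `ξ(λ) = T/arccosh(1/(2λ))` and
`σ(λ) = T²/(4√(1−4λ²))` are differentiable and strictly increasing on `(0, 1/2)`, and the
ratio of their derivatives tends to `4/T` as `λ → (1/2)⁻`. -/
theorem xi_flat_vs_wannier_spread_slope (T : ℝ) (hT : 0 < T) (ξ σ : ℝ → ℝ)
    (hξ : ∀ l : ℝ, ξ l = T / arccosh (1 / (2 * l)))
    (hσ : ∀ l : ℝ, σ l = T ^ 2 / (4 * Real.sqrt (1 - 4 * l ^ 2))) :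
    (∀ l ∈ Set.Ioo (0 : ℝ) (1 / 2), DifferentiableAt ℝ ξ l) ∧
    (∀ l ∈ Set.Ioo (0 : ℝ) (1 / 2), DifferentiableAt ℝ σ l) ∧
    StrictMonoOn ξ (Set.Ioo (0 : ℝ) (1 / 2)) ∧
    StrictMonoOn σ (Set.Ioo (0 : ℝ) (1 / 2)) ∧
    Tendsto (fun l : ℝ => deriv ξ l / deriv σ l)
      (nhdsWithin (1 / 2) (Set.Iio (1 / 2))) (nhds (4 / T)) := by
  obtain rfl : ξ = fun l => T / Real.arcosh (1 / (2 * l)) := funext hξ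
  obtain rfl : σ = fun l => T ^ 2 / (4 * √(1 - 4 * l ^ 2)) := funext hσ
  refine ⟨fun l hl => (hasDerivAt_div_arcosh_one_div_two_mul T hl).differentiableAt,
    fun l hl => (hasDerivAt_div_sqrt_one_sub_four_mul_sq T hl).differentiableAt, ?_, ?_, ?_⟩
  · intro a ha b hb hab
    have ha0 := ha.1
    have hb1 := one_lt_one_div_two_mul hb
    refine div_lt_div_of_pos_left hT (Real.arcosh_pos hb1) ?_
    have hlt : 1 / (2 * b) < 1 / (2 * a) :=
      one_div_lt_one_div_of_lt (by positivity) (by linarith)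
    exact (Real.arcosh_lt_arcosh (by linarith) (by linarith)).2 hlt
  · intro a ha b hb hab
    have hb0 := one_sub_four_mul_sq_pos hb
    have hsb := Real.sqrt_pos.2 hb0
    refine div_lt_div_of_pos_left (by positivity) (by positivity) ?_
    have hlt : √(1 - 4 * b ^ 2) < √(1 - 4 * a ^ 2) :=
      Real.sqrt_lt_sqrt hb0.le (by nlinarith [ha.1])
    linarith
  · have h := ((tendsto_sinh_div_self.comp tendsto_arcosh_one_div_two_mul).pow 2).const_mul (4 / T)
    rw [one_pow, mul_one] at h
    refine h.congr' ?_
    filter_upwards [Ioo_zero_half_mem_nhdsWithin] with l hl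
    rw [(hasDerivAt_div_arcosh_one_div_two_mul T hl).deriv,
      (hasDerivAt_div_sqrt_one_sub_four_mul_sq T hl).deriv, Function.comp_apply,
      sinh_arcosh_one_div_two_mul hl]
    have hl0 := hl.1
    have hA := Real.arcosh_pos (one_lt_one_div_two_mul hl)
    have hs : 0 < √(1 - 4 * l ^ 2) := Real.sqrt_pos.2 (one_sub_four_mul_sq_pos hl)
    generalize Real.arcosh (1 / (2 * l)) = A at *
    generalize √(1 - 4 * l ^ 2) = s at *
    field_simp
    ring
end

section
/- Let λ be a real number with 0 < λ < 1/2 and set γ = arccosh(1/(2λ)). Then the function k ↦ (1 + 2λ·cos k)^{−1/2} on ℝ extends to a holomorphic function on the strip {z ∈ ℂ : |Im z| < γ}, and consequently for every ε ∈ (0, γ) there exists C_ε > 0 such that its Fourier coefficients F(n) = (1/(2π)) ∫_{−π}^{π} e^{−ink}·(1 + 2λ·cos k)^{−1/2} dk satisfy |F(n)| ≤ C_ε·e^{−(γ−ε)|n|} for all n ∈ ℤ. -/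
open Complex Real

/-- The real part of `1 + 2λ cos z` is positive on the strip `|Im z| < arccosh (1/(2λ))`. -/
lemma one_add_two_mul_cos_mem_slitPlane {lam : ℝ} (h0 : 0 < lam) (h1 : lam < 1 / 2) {z : ℂ}
    (hz : |z.im| < arccosh (1 / (2 * lam))) :
    1 + 2 * (lam : ℂ) * Complex.cos z ∈ Complex.slitPlane := by
  have hx : 1 ≤ 1 / (2 * lam) := by
    rw [le_div_iff₀ (by positivity)]
    linarith
  have hcosh : Real.cosh z.im < 1 / (2 * lam) := by
    have hγ : Real.cosh (arccosh (1 / (2 * lam))) = 1 / (2 * lam) := Real.cosh_arcosh hx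
    rw [← hγ]
    exact Real.cosh_lt_cosh.2 (hz.trans_le (le_abs_self _))
  rw [lt_div_iff₀ (by positivity)] at hcosh
  have hre : (1 + 2 * (lam : ℂ) * Complex.cos z).re
      = 1 + 2 * lam * (Real.cos z.re * Real.cosh z.im) := by
    rw [Complex.cos_eq z, ← Complex.ofReal_cos, ← Complex.ofReal_cosh, ← Complex.ofReal_sin,
      ← Complex.ofReal_sinh]
    simp [Complex.cos_ofReal_re]
  refine Or.inl ?_
  rw [hre]
  nlinarith [Real.neg_one_le_cos z.re, Real.cosh_pos z.im,
    mul_nonneg (mul_pos h0 (Real.cosh_pos z.im)).le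
      (by linarith [Real.neg_one_le_cos z.re] : 0 ≤ Real.cos z.re + 1)]

/-- The integral over a period of a `2π`-periodic function holomorphic on a horizontal strip is
unchanged when the contour is shifted vertically inside the strip. -/
lemma integral_eq_integral_shift_of_periodic {f : ℂ → ℂ} {γ b : ℝ}
    (hf : DifferentiableOn ℂ f {z : ℂ | |z.im| < γ})
    (hper : Function.Periodic f (2 * Real.pi)) (hb : |b| < γ) :
    ∫ x in (-Real.pi)..Real.pi, f x = ∫ x in (-Real.pi)..Real.pi, f (x + b * Complex.I) := by
  have H := Complex.integral_boundary_rect_eq_zero_of_differentiableOn f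
    (-Real.pi : ℝ) (Real.pi + b * Complex.I) (hf.mono ?_)
  · have hside : ∀ y : ℝ, f (Real.pi + y * Complex.I) = f (-Real.pi + y * Complex.I) := by
      intro y
      rw [← hper (-Real.pi + y * Complex.I)]
      ring_nf
    simpa [hside, sub_eq_zero] using H
  · intro z hz
    have him : z.im ∈ Set.uIcc 0 b := by simpa using hz.2
    have := Set.abs_sub_left_of_mem_uIcc him
    simp only [sub_zero] at this
    exact this.trans_lt hb

/-- Fourier coefficients of a `2π`-periodic function holomorphic on `|Im z| < γ` decay
exponentially at every rate `a < γ`. -/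
lemma exists_norm_fourier_integral_le {f : ℂ → ℂ} {γ a : ℝ}
    (hf : DifferentiableOn ℂ f {z : ℂ | |z.im| < γ})
    (hper : Function.Periodic f (2 * Real.pi)) (ha : 0 ≤ a) (haγ : a < γ) :
    ∃ C : ℝ, 0 < C ∧ ∀ n : ℤ,
      ‖∫ x in (-Real.pi)..Real.pi, Complex.exp (-Complex.I * (n : ℂ) * (x : ℂ)) * f x‖
        ≤ C * Real.exp (-a * |(n : ℝ)|) := by
  have hbound : ∀ b : ℝ, |b| < γ → ∃ M : ℝ, 0 < M ∧ ∀ n : ℤ,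
      ‖∫ x in (-Real.pi)..Real.pi, Complex.exp (-Complex.I * (n : ℂ) * (x : ℂ)) * f x‖
        ≤ M * Real.exp (n * b) := by
    intro b hb
    have hcont : Continuous fun x : ℝ => f (x + b * Complex.I) :=
      hf.continuousOn.comp_continuous (by fun_prop) (by intro x; simpa using hb)
    obtain ⟨M, hM⟩ := isCompact_Icc.exists_bound_of_continuousOn
      (s := Set.Icc (-Real.pi) Real.pi) hcont.continuousOn
    refine ⟨(|M| + 1) * (2 * Real.pi), by positivity, fun n => ?_⟩
    have hdiff : DifferentiableOn ℂ (fun z => Complex.exp (-Complex.I * (n : ℂ) * z) * f z)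
        {z : ℂ | |z.im| < γ} :=
      DifferentiableOn.mul (by fun_prop) hf
    have hperiodic : Function.Periodic
        (fun z => Complex.exp (-Complex.I * (n : ℂ) * z) * f z) (2 * Real.pi) := by
      intro z
      have hexp : -Complex.I * (n : ℂ) * (z + 2 * Real.pi)
          = -Complex.I * n * z - n * (2 * Real.pi * Complex.I) := by ring
      simp only [hper z, hexp, Complex.exp_periodic.sub_int_mul_eq]
    rw [integral_eq_integral_shift_of_periodic hdiff hperiodic hb]
    refine (intervalIntegral.norm_integral_le_of_norm_le_const
      (C := Real.exp (n * b) * (|M| + 1)) fun x hx => ?_).trans_eq ?_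
    · rw [Set.uIoc_of_le (by linarith [Real.pi_pos])] at hx
      rw [norm_mul, Complex.norm_exp]
      have hre : (-Complex.I * (n : ℂ) * (x + b * Complex.I)).re = n * b := by simp
      rw [hre]
      gcongr
      linarith [hM x ⟨hx.1.le, hx.2⟩, le_abs_self M]
    · rw [show Real.pi - -Real.pi = 2 * Real.pi by ring, abs_of_pos Real.two_pi_pos]
      ring
  obtain ⟨M₁, hM₁, h₁⟩ := hbound a (by rwa [abs_of_nonneg ha])
  obtain ⟨M₂, hM₂, h₂⟩ := hbound (-a) (by rwa [abs_neg, abs_of_nonneg ha])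
  refine ⟨M₁ + M₂, by positivity, fun n => ?_⟩
  rcases le_total (n : ℝ) 0 with hn | hn
  · rw [abs_of_nonpos hn, show -a * -(n : ℝ) = n * a by ring]
    refine (h₁ n).trans ?_
    gcongr
    linarith
  · rw [abs_of_nonneg hn, show -a * (n : ℝ) = n * -a by ring]
    refine (h₂ n).trans ?_
    gcongr
    linarith

/-- **Holomorphic extension of the inverse Bloch normalization and decay of its Fourier
coefficients.** For `0 < λ < 1/2` and `γ = arccosh(1/(2λ))`, the function
`k ↦ (1 + 2λ cos k)^{−1/2}` extends holomorphically to the strip `{z : |Im z| < γ}`, and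
its Fourier coefficients satisfy `|F(n)| ≤ C_ε e^{−(γ−ε)|n|}` for every `ε ∈ (0, γ)`. -/
theorem inverse_normalization_extension_and_decay (lam : ℝ) (h0 : 0 < lam) (h1 : lam < 1 / 2)
    (γ : ℝ) (hγ : γ = arccosh (1 / (2 * lam))) :
    (∃ F : ℂ → ℂ, DifferentiableOn ℂ F {z : ℂ | |z.im| < γ} ∧
      ∀ x : ℝ, F (x : ℂ) = (((1 + 2 * lam * Real.cos x) ^ (-(1 / 2) : ℝ) : ℝ) : ℂ)) ∧
    ∀ ε : ℝ, 0 < ε → ε < γ → ∃ C : ℝ, 0 < C ∧ ∀ n : ℤ,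
      ‖(1 / (2 * Real.pi)) • ∫ k in (-Real.pi)..Real.pi,
          Complex.exp (-Complex.I * (n : ℂ) * (k : ℂ)) *
            (((1 + 2 * lam * Real.cos k) ^ (-(1 / 2) : ℝ) : ℝ) : ℂ)‖
        ≤ C * Real.exp (-(γ - ε) * |(n : ℝ)|) := by
  subst hγ
  set f : ℂ → ℂ := fun z => (1 + 2 * (lam : ℂ) * Complex.cos z) ^ (-(1 / 2) : ℂ) with hf_def
  have hf : DifferentiableOn ℂ f {z : ℂ | |z.im| < arccosh (1 / (2 * lam))} :=
    DifferentiableOn.cpow (by fun_prop) (by fun_prop)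
      fun z hz => one_add_two_mul_cos_mem_slitPlane h0 h1 hz
  have hper : Function.Periodic f (2 * Real.pi) := fun z => by
    simp only [hf_def, Complex.cos_add_two_pi]
  have hreal : ∀ x : ℝ,
      f (x : ℂ) = (((1 + 2 * lam * Real.cos x) ^ (-(1 / 2) : ℝ) : ℝ) : ℂ) := by
    intro x
    have hpos : 0 ≤ 1 + 2 * lam * Real.cos x := by nlinarith [Real.neg_one_le_cos x]
    rw [Complex.ofReal_cpow hpos]
    simp [hf_def]
  refine ⟨⟨f, hf, hreal⟩, fun ε hε hεγ => ?_⟩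
  obtain ⟨C, hC, hbound⟩ := exists_norm_fourier_integral_le hf hper
    (a := arccosh (1 / (2 * lam)) - ε) (by linarith) (by linarith)
  refine ⟨1 / (2 * Real.pi) * C, by positivity, fun n => ?_⟩
  simp only [← hreal]
  rw [norm_smul, Real.norm_of_nonneg (by positivity), mul_assoc]
  gcongr
  exact hbound n
end
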